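/- Let F be a field of characteristic not 2 and let a, b be nonzero elements of F. The quaternion algebra (a,b/F) is a division ring if and only if the ternary quadratic form Q(x, y, z) = −a·x² − b·y² + a·b·z² is anisotropic over F, i.e. Q(x, y, z) = 0 with x, y, z ∈ F implies x = y = z = 0. -/

import Mathlib

open Quaternion

namespace QuaternionAlgebra

theorem star_mul_self_eq_coe_norm {R : Type*} [CommRing R] {a b : R} (u : ℍ[R, a, b]) :
    star u * u =
      ((u.re ^ 2 - a * u.imI ^ 2 - b * u.imJ ^ 2 + a * b * u.imK ^ 2 : R) : ℍ[R, a, b]) := by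
  rw [star_mul_eq_coe]
  congr 1
  simp
  ring

theorem mul_star_self_eq_coe_norm {R : Type*} [CommRing R] {a b : R} (u : ℍ[R, a, b]) :
    u * star u =
      ((u.re ^ 2 - a * u.imI ^ 2 - b * u.imJ ^ 2 + a * b * u.imK ^ 2 : R) : ℍ[R, a, b]) := by
  rw [mul_star_eq_coe]
  congr 1
  simp
  ring

theorem isUnit_of_norm_ne_zero {F : Type*} [Field F] {a b : F} {u : ℍ[F, a, b]}
    (hu : u.re ^ 2 - a * u.imI ^ 2 - b * u.imJ ^ 2 + a * b * u.imK ^ 2 ≠ 0) : IsUnit u := by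
  refine isUnit_iff_exists.mpr
    ⟨(u.re ^ 2 - a * u.imI ^ 2 - b * u.imJ ^ 2 + a * b * u.imK ^ 2)⁻¹ • star u, ?_, ?_⟩
  · rw [mul_smul_comm, mul_star_self_eq_coe_norm, smul_coe, inv_mul_cancel₀ hu, coe_one]
  · rw [smul_mul_assoc, star_mul_self_eq_coe_norm, smul_coe, inv_mul_cancel₀ hu, coe_one]

end QuaternionAlgebra

/-- If the ternary form `−a x² − b y² + a b z²` is anisotropic, then so is the quaternary norm form
of `(a,b/F)`. -/
theorem norm_form_anisotropic_of_ternary_anisotropic {F : Type*} [Field F] {a b : F} (ha : a ≠ 0)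
    (h : ∀ x y z : F, -a * x ^ 2 - b * y ^ 2 + a * b * z ^ 2 = 0 → x = 0 ∧ y = 0 ∧ z = 0)
    {t x y z : F} (hN : t ^ 2 - a * x ^ 2 - b * y ^ 2 + a * b * z ^ 2 = 0) :
    t = 0 ∧ x = 0 ∧ y = 0 ∧ z = 0 := by
  obtain ⟨-, hxz, -⟩ := h (b * (t * z + x * y)) (a * (x ^ 2 - b * z ^ 2)) (t * x + b * y * z)
    (by linear_combination a * b * (x ^ 2 - b * z ^ 2) * hN)
  replace hxz : x ^ 2 - b * z ^ 2 = 0 := (mul_eq_zero.mp hxz).resolve_left ha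
  obtain ⟨hx, -, hz⟩ := h x 0 z (by linear_combination -a * hxz)
  obtain ⟨ht, -, hy⟩ := h t 0 y (by linear_combination -a * hN - a ^ 2 * hxz)
  exact ⟨ht, hx, hy, hz⟩

/-- For a field `F` of characteristic not 2 and nonzero `a b : F`,
the quaternion algebra `(a,b/F)` is a division ring iff the ternary quadratic form
`Q(x,y,z) = −a x² − b y² + a b z²` is anisotropic over `F`. -/
theorem quaternionAlgebra_isDivisionRing_iff_ternary_anisotropic
    (F : Type*) [Field F] (hchar : (2 : F) ≠ 0) (a b : F) (ha : a ≠ 0) (hb : b ≠ 0) :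
    (∀ u : ℍ[F, a, b], u ≠ 0 → IsUnit u) ↔
      (∀ x y z : F, -a * x ^ 2 - b * y ^ 2 + a * b * z ^ 2 = 0 →
        x = 0 ∧ y = 0 ∧ z = 0) := by
  constructor
  · intro h x y z hQ
    have hsq : (⟨0, x, y, z⟩ : ℍ[F, a, b]) * ⟨0, x, y, z⟩ = 0 := by
      ext
      · simp only [QuaternionAlgebra.mk_mul_mk, QuaternionAlgebra.re_zero]
        linear_combination -hQ
      all_goals
        simp
        ring
    have hu : (⟨0, x, y, z⟩ : ℍ[F, a, b]) = 0 := by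
      by_contra hne
      exact hne ((h _ hne).mul_right_eq_zero.mp hsq)
    exact ⟨congrArg QuaternionAlgebra.imI hu, congrArg QuaternionAlgebra.imJ hu,
      congrArg QuaternionAlgebra.imK hu⟩
  · intro h u hu
    refine QuaternionAlgebra.isUnit_of_norm_ne_zero fun hN => hu ?_
    obtain ⟨h₁, h₂, h₃, h₄⟩ := norm_form_anisotropic_of_ternary_anisotropic ha h hN
    exact QuaternionAlgebra.ext h₁ h₂ h₃ h₄
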